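/- If P ⊆ ℝ⁷ is an associative 3-plane with dim(P ∩ A) ≥ 2 (equivalently, P ∩ A contains two orthonormal vectors), then P = A. -/

import Mathlib

open Real

noncomputable section

/-- ℝ⁷ with its Euclidean structure. -/
abbrev E7 := EuclideanSpace ℝ (Fin 7)

/-- The standard orthonormal basis vectors of ℝ⁷ (0-indexed: `e 0` is e₁, ..., `e 6` is e₇). -/
def e (i : Fin 7) : E7 := EuclideanSpace.single i (1 : ℝ)

/-- `trip i j k u v w` is `e^{i+1,j+1,k+1}(u,v,w)`: the determinant of the 3×3 matrix whose
columns are the (i,j,k)-coordinates of u, v, w. -/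
def trip (i j k : Fin 7) (u v w : E7) : ℝ :=
  Matrix.det !![u i, v i, w i; u j, v j, w j; u k, v k, w k]

/-- The standard G₂ 3-form φ₀ = e^{123} + e^{145} + e^{167} + e^{246} − e^{257} − e^{347} − e^{356}. -/
def phi0 (u v w : E7) : ℝ :=
  trip 0 1 2 u v w + trip 0 3 4 u v w + trip 0 5 6 u v w + trip 1 3 5 u v w
    - trip 1 4 6 u v w - trip 2 3 6 u v w - trip 2 4 5 u v w

/-- A 3-plane is associative if it is the span of an orthonormal triple (u₁,u₂,u₃) with
φ₀(u₁,u₂,u₃) = 1. -/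
def IsAssociative (P : Submodule ℝ E7) : Prop :=
  ∃ u₁ u₂ u₃ : E7, Orthonormal ℝ ![u₁, u₂, u₃] ∧ phi0 u₁ u₂ u₃ = 1 ∧
    P = Submodule.span ℝ {u₁, u₂, u₃}

/-- The associative 3-plane A = span(e₁, e₂, e₃). -/
def A : Submodule ℝ E7 := Submodule.span ℝ {e 0, e 1, e 2}

/-- The `(i,j)` minor of `(u,v)`. -/
def minor2 (u v : E7) (i j : Fin 7) : ℝ := u i * v j - u j * v i

/-- The cross product on ℝ⁷ dual to `phi0`. -/
def cross7 (u v : E7) : E7 :=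
  !₂[minor2 u v 1 2 + minor2 u v 3 4 + minor2 u v 5 6,
     minor2 u v 2 0 + minor2 u v 3 5 - minor2 u v 4 6,
     minor2 u v 0 1 - minor2 u v 3 6 - minor2 u v 4 5,
     minor2 u v 4 0 + minor2 u v 5 1 - minor2 u v 6 2,
     minor2 u v 0 3 - minor2 u v 6 1 - minor2 u v 5 2,
     minor2 u v 6 0 + minor2 u v 1 3 - minor2 u v 2 4,
     minor2 u v 0 5 - minor2 u v 1 4 - minor2 u v 2 3]

lemma inner7 (u v : E7) : inner ℝ u v = u 0 * v 0 + u 1 * v 1 + u 2 * v 2 + u 3 * v 3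
    + u 4 * v 4 + u 5 * v 5 + u 6 * v 6 := by
  simp [PiLp.inner_apply, Fin.sum_univ_succ]
  ring

lemma inner_cross7 (u v w : E7) : inner ℝ (cross7 u v) w = phi0 u v w := by
  simp [inner7, cross7, phi0, trip, minor2, Matrix.det_fin_three]
  ring

lemma cross7_sq (u v : E7) : inner ℝ (cross7 u v) (cross7 u v)
    = inner ℝ u u * inner ℝ v v - (inner ℝ u v) ^ 2 := by
  rw [inner7, inner7, inner7, inner7]
  simp [cross7, minor2]
  ring

lemma cross7_left (u v : E7) : inner ℝ (cross7 u v) u = (0 : ℝ) := by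
  simp [inner7, cross7, minor2]
  ring

lemma cross7_right (u v : E7) : inner ℝ (cross7 u v) v = (0 : ℝ) := by
  simp [inner7, cross7, minor2]
  ring

lemma phi0_rot (u v w : E7) : phi0 v w u = phi0 u v w := by
  simp [phi0, trip, Matrix.det_fin_three]
  ring

lemma cross7_add_left (u v w : E7) : cross7 (u + v) w = cross7 u w + cross7 v w := by
  ext i
  fin_cases i <;> simp [cross7, minor2] <;> ring

lemma cross7_smul_left (r : ℝ) (u w : E7) : cross7 (r • u) w = r • cross7 u w := by
  ext i
  fin_cases i <;> simp [cross7, minor2] <;> ring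

lemma cross7_anti (u v : E7) : cross7 u v = - cross7 v u := by
  ext i
  fin_cases i <;> simp [cross7, minor2] <;> ring

lemma cross7_self (u : E7) : cross7 u u = 0 := by
  ext i
  fin_cases i <;> simp [cross7, minor2] <;> ring

lemma cross7_add_right (u v w : E7) : cross7 w (u + v) = cross7 w u + cross7 w v := by
  rw [cross7_anti, cross7_add_left, cross7_anti w u, cross7_anti w v]
  abel

lemma cross7_smul_right (r : ℝ) (u w : E7) : cross7 w (r • u) = r • cross7 w u := by
  rw [cross7_anti, cross7_smul_left, cross7_anti w u, smul_neg]

/-- The equality case of the associator inequality. -/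
lemma cross7_eq {u v w : E7} (hu : inner ℝ u u = (1 : ℝ)) (hv : inner ℝ v v = (1 : ℝ))
    (hw : inner ℝ w w = (1 : ℝ)) (huv : inner ℝ u v = (0 : ℝ)) (h : phi0 u v w = 1) :
    cross7 u v = w := by
  have h1 : inner ℝ (cross7 u v - w) (cross7 u v - w) = (0 : ℝ) := by
    rw [inner_sub_left, inner_sub_right, inner_sub_right, cross7_sq, hu, hv, hw, huv,
      real_inner_comm (cross7 u v) w, inner_cross7, h]
    norm_num
  exact sub_eq_zero.mp (inner_self_eq_zero.mp h1)

lemma orth3 {u v w : E7} : Orthonormal ℝ ![u, v, w] ↔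
    (inner ℝ u u = (1 : ℝ) ∧ inner ℝ v v = (1 : ℝ) ∧ inner ℝ w w = (1 : ℝ)) ∧
    inner ℝ u v = (0 : ℝ) ∧ inner ℝ u w = (0 : ℝ) ∧ inner ℝ v w = (0 : ℝ) := by
  rw [orthonormal_iff_ite]
  constructor
  · intro h
    exact ⟨⟨by simpa using h 0 0, by simpa using h 1 1, by simpa using h 2 2⟩,
      by simpa using h 0 1, by simpa using h 0 2, by simpa using h 1 2⟩
  · rintro ⟨⟨h1, h2, h3⟩, h4, h5, h6⟩ i j
    have h4' := h4
    have h5' := h5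
    have h6' := h6
    rw [real_inner_comm] at h4' h5' h6'
    fin_cases i <;> fin_cases j <;> simp only [Fin.zero_eta, Fin.mk_one, Fin.reduceFinMk,
      Matrix.cons_val, h1, h2, h3, h4, h5, h6, h4', h5', h6'] <;> simp

/-- A subspace spanned by three vectors closed under cross products is closed under them. -/
lemma cross7_mem_span {x y z a b : E7}
    (hxy : cross7 x y ∈ Submodule.span ℝ {x, y, z})
    (hyz : cross7 y z ∈ Submodule.span ℝ {x, y, z})
    (hzx : cross7 z x ∈ Submodule.span ℝ {x, y, z})
    (ha : a ∈ Submodule.span ℝ {x, y, z}) (hb : b ∈ Submodule.span ℝ {x, y, z}) :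
    cross7 a b ∈ Submodule.span ℝ {x, y, z} := by
  have hyx := neg_mem hxy
  have hzy := neg_mem hyz
  have hxz := neg_mem hzx
  rw [← cross7_anti] at hyx hzy hxz
  obtain ⟨a1, a2, a3, rfl⟩ := Submodule.mem_span_triple.mp ha
  obtain ⟨b1, b2, b3, rfl⟩ := Submodule.mem_span_triple.mp hb
  simp only [cross7_add_left, cross7_add_right, cross7_smul_left, cross7_smul_right, cross7_self]
  repeat' first
    | assumption
    | exact zero_mem _
    | apply Submodule.smul_mem
    | apply add_mem

lemma cross7_e01 : cross7 (e 0) (e 1) = e 2 := by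
  ext i
  fin_cases i <;> simp [cross7, minor2, e]

lemma cross7_e12 : cross7 (e 1) (e 2) = e 0 := by
  ext i
  fin_cases i <;> simp [cross7, minor2, e]

lemma cross7_e20 : cross7 (e 2) (e 0) = e 1 := by
  ext i
  fin_cases i <;> simp [cross7, minor2, e]

/-- An associative 3-plane meeting A in dimension at least 2 must equal A. -/
theorem statement4 (P : Submodule ℝ E7) (hP : IsAssociative P)
    (h : 2 ≤ Module.finrank ℝ ↥(P ⊓ A)) : P = A := by
  obtain ⟨u, v, w, ho, hphi, rfl⟩ := hP
  obtain ⟨⟨hu, hv, hw⟩, huv, huw, hvw⟩ := orth3.mp ho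
  have hwu : inner ℝ w u = (0 : ℝ) := by rw [real_inner_comm]; exact huw
  have c1 : cross7 u v = w := cross7_eq hu hv hw huv hphi
  have c2 : cross7 v w = u := cross7_eq hv hw hu hvw (by rw [phi0_rot, hphi])
  have c3 : cross7 w u = v := cross7_eq hw hu hv hwu (by rw [phi0_rot, phi0_rot, hphi])
  set P := Submodule.span ℝ {u, v, w} with hPdef
  let B := stdOrthonormalBasis ℝ ↥(P ⊓ A)
  let i : Fin (Module.finrank ℝ ↥(P ⊓ A)) := ⟨0, by omega⟩
  let j : Fin (Module.finrank ℝ ↥(P ⊓ A)) := ⟨1, by omega⟩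
  have hij : i ≠ j := by simp [i, j]
  have hB := orthonormal_iff_ite.mp B.orthonormal
  have haa : inner ℝ (B i : E7) (B i : E7) = (1 : ℝ) := (hB i i).trans (if_pos rfl)
  have hbb : inner ℝ (B j : E7) (B j : E7) = (1 : ℝ) := (hB j j).trans (if_pos rfl)
  have hab : inner ℝ (B i : E7) (B j : E7) = (0 : ℝ) := (hB i j).trans (if_neg hij)
  have ha := (B i).2
  have hb := (B j).2
  generalize (B i : E7) = a at *
  generalize (B j : E7) = b at *
  have hcP : cross7 a b ∈ P := by
    apply cross7_mem_span _ _ _ ha.1 hb.1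
    · rw [c1]; exact Submodule.subset_span (by simp)
    · rw [c2]; exact Submodule.subset_span (by simp)
    · rw [c3]; exact Submodule.subset_span (by simp)
  have hcA : cross7 a b ∈ A := by
    apply cross7_mem_span _ _ _ ha.2 hb.2
    · rw [cross7_e01]; exact Submodule.subset_span (by simp)
    · rw [cross7_e12]; exact Submodule.subset_span (by simp)
    · rw [cross7_e20]; exact Submodule.subset_span (by simp)
  have hc : Orthonormal ℝ ![a, b, cross7 a b] := by
    refine orth3.mpr ⟨⟨haa, hbb, ?_⟩, hab, ?_, ?_⟩
    · rw [cross7_sq, haa, hbb, hab]; norm_num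
    · rw [real_inner_comm]; exact cross7_left a b
    · rw [real_inner_comm]; exact cross7_right a b
  have hdim := finrank_span_eq_card hc.linearIndependent
  have key : ∀ x y z : E7, a ∈ Submodule.span ℝ {x, y, z} → b ∈ Submodule.span ℝ {x, y, z} →
      cross7 a b ∈ Submodule.span ℝ {x, y, z} →
      Submodule.span ℝ (Set.range ![a, b, cross7 a b]) = Submodule.span ℝ {x, y, z} := by
    intro x y z h1 h2 h3
    apply Submodule.eq_of_le_of_finrank_le
    · rw [Submodule.span_le]
      rintro _ ⟨k, rfl⟩
      fin_cases k
      exacts [h1, h2, h3]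
    · rw [hdim]
      have hr : Set.range ![x, y, z] = {x, y, z} := by
        simp only [Matrix.range_cons, Matrix.range_empty, Set.union_empty, Set.singleton_union]
      rw [← hr]
      exact finrank_range_le_card _
  exact (key u v w ha.1 hb.1 hcP).symm.trans (key _ _ _ ha.2 hb.2 hcA)
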